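/- arXiv:math/0702797 — 2 statements merged into one kernel-verified Lean document; each statement's English description precedes it below -/
import Mathlib

section
/- Let k ≥ 1. For all integers d ≥ 0, s ≥ 0 and w ∈ ℤ, the dimension over ℂ of the homogeneous component of A_k of q-degree d, z-degree 2w and u-degree s is at most the dimension over ℂ of the homogeneous component of B_k of q-degree d, z-degree 2w and u-degree s. -/
open MvPolynomial

/-- Variable index type for the algebras `A_k`, `B_k`:
`(0, n)` is `ẽ_{n+1}`, `(1, n)` is `h̃_{n+1}`, `(2, n)` is `f̃_{n+1}`. -/
abbrev Vr : Type := Fin 3 × ℕ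

/-- z-degrees of the three families of variables: `deg_z ẽ = 2`, `deg_z h̃ = 0`, `deg_z f̃ = -2`. -/
def zdeg3 : Fin 3 → ℤ := ![2, 0, -2]

/-- q-degree of a monomial: `deg_q x̃_n = n` (the variable `(x, n)` is `x̃_{n+1}`). -/
def qdegMon (u : Vr →₀ ℕ) : ℕ := u.sum fun v m => m * (v.2 + 1)

/-- z-degree of a monomial. -/
def zdegMon (u : Vr →₀ ℕ) : ℤ := u.sum fun v m => (m : ℤ) * zdeg3 v.1

/-- u-degree of a monomial: every variable has u-degree 1. -/
def udegMon (u : Vr →₀ ℕ) : ℕ := u.sum fun _ m => m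

/-- The span of the monomials of q-degree `d`, z-degree `z` and u-degree `s`. -/
noncomputable def comp3 (d : ℕ) (z : ℤ) (s : ℕ) : Submodule ℂ (MvPolynomial Vr ℂ) :=
  Submodule.span ℂ
    { p | ∃ u : Vr →₀ ℕ, qdegMon u = d ∧ zdegMon u = z ∧ udegMon u = s ∧ p = monomial u 1 }

/-- The coefficient of the product of `k+1` series `x̃(z) = ∑_{n ≥ 1} x̃_n z^{n-1}` of the
types prescribed by `ty`, at the `N`-th place (indices of the variables summing to `N + (k+1)`). -/
noncomputable def genSeries (k : ℕ) (ty : Fin (k + 1) → Fin 3) (N : ℕ) : MvPolynomial Vr ℂ :=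
  ∑ t ∈ Finset.Nat.antidiagonalTuple (k + 1) N, ∏ j, X (ty j, t j)

/-- The defining ideal of `B_k`: generated by the coefficients of
`ẽ(z)^i h̃(z)^{k+1-i}` for `1 ≤ i ≤ k+1` and of `h̃(z)^i f̃(z)^{k+1-i}` for `0 ≤ i ≤ k+1`. -/
noncomputable def idealB (k : ℕ) : Ideal (MvPolynomial Vr ℂ) :=
  Ideal.span
    ({ p | ∃ i, 1 ≤ i ∧ i ≤ k + 1 ∧
        ∃ N, p = genSeries k (fun j => if (j : ℕ) < i then (0 : Fin 3) else 1) N } ∪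
     { p | ∃ i, i ≤ k + 1 ∧
        ∃ N, p = genSeries k (fun j => if (j : ℕ) < i then (1 : Fin 3) else 2) N })

/-- The `sl₂`-lowering derivation `D` with `D ẽ_n = h̃_n`, `D h̃_n = 2 f̃_n`, `D f̃_n = 0`. -/
noncomputable def Dlow : Derivation ℂ (MvPolynomial Vr ℂ) (MvPolynomial Vr ℂ) :=
  mkDerivation ℂ (fun v =>
    if v.1 = 0 then X (1, v.2) else if v.1 = 1 then (2 : ℂ) • X (2, v.2) else 0)

/-- The defining ideal of `A_k`: generated by the coefficients of the `2k+3` series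
`D^j (ẽ(z)^{k+1})`, `0 ≤ j ≤ 2k+2`. -/
noncomputable def idealA (k : ℕ) : Ideal (MvPolynomial Vr ℂ) :=
  Ideal.span
    { p | ∃ j ≤ 2 * k + 2, ∃ N, p = (Dlow.toLinearMap ^ j) (genSeries k (fun _ => 0) N) }

/-- `(q)_n = ∏_{i=1}^n (1 - q^i)` in `ℤ[[q]]`. -/
noncomputable def qPoch (n : ℕ) : PowerSeries ℤ :=
  ∏ i ∈ Finset.range n, (1 - PowerSeries.X ^ (i + 1))

/-- The inverse `1/(q)_n` in `ℤ[[q]]` (well defined since `(q)_n` has constant term `1`). -/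
noncomputable def qPochInv (n : ℕ) : PowerSeries ℤ := PowerSeries.invOfUnit (qPoch n) 1


/-- The multidegree of a variable: its q-, z- and u-degree, followed by its degree in the family
`h̃`. -/
def wt (v : Vr) : (ℕ × ℤ × ℕ) × ℕ :=
  ((v.2 + 1, zdeg3 v.1, 1), if v.1 = 1 then 1 else 0)

lemma weight_wt_fst (u : Vr →₀ ℕ) :
    (Finsupp.weight wt u).1 = (qdegMon u, zdegMon u, udegMon u) := by
  simp [Finsupp.weight_apply, Finsupp.sum, wt, qdegMon, zdegMon, udegMon, Prod.fst_sum,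
    Prod.snd_sum, Prod.ext_iff]

/-- The span of the multihomogeneous polynomials of multidegree `(δ, n)` with `n < m`. -/
noncomputable def lowerComp (δ : ℕ × ℤ × ℕ) (m : ℕ) : Submodule ℂ (MvPolynomial Vr ℂ) :=
  ⨆ m' < m, weightedHomogeneousSubmodule ℂ wt (δ, m')

lemma mem_lowerComp_of_lt {δ : ℕ × ℤ × ℕ} {m m' : ℕ} (h : m' < m)
    {p : MvPolynomial Vr ℂ} (hp : IsWeightedHomogeneous wt p (δ, m')) : p ∈ lowerComp δ m :=
  (le_iSup₂_of_le (f := fun m' (_ : m' < m) => weightedHomogeneousSubmodule ℂ wt (δ, m'))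
    m' h le_rfl) hp

lemma monomial_mul_mem_lowerComp {δ : ℕ × ℤ × ℕ} {m : ℕ} {p : MvPolynomial Vr ℂ}
    (hp : p ∈ lowerComp δ m) (u : Vr →₀ ℕ) (c : ℂ) :
    monomial u c * p ∈
      lowerComp ((Finsupp.weight wt u).1 + δ) ((Finsupp.weight wt u).2 + m) := by
  suffices lowerComp δ m ≤ (lowerComp ((Finsupp.weight wt u).1 + δ)
      ((Finsupp.weight wt u).2 + m)).comap (LinearMap.mulLeft ℂ (monomial u c)) from this hp
  refine iSup₂_le fun m' hm' q hq => ?_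
  refine mem_lowerComp_of_lt (m' := (Finsupp.weight wt u).2 + m') (by omega) ?_
  exact (isWeightedHomogeneous_monomial wt u c rfl).mul hq

lemma genSeries_isWeightedHomogeneous (k : ℕ) (ty : Fin (k + 1) → Fin 3) (N : ℕ) :
    IsWeightedHomogeneous wt (genSeries k ty N)
      ((N + (k + 1), ∑ i, zdeg3 (ty i), k + 1), Fintype.card {i // ty i = 1}) := by
  refine IsWeightedHomogeneous.sum _ _ _ fun t ht => ?_
  convert! IsWeightedHomogeneous.prod Finset.univ _ (fun i => wt (ty i, t i))
    fun i _ => isWeightedHomogeneous_X ℂ wt (ty i, t i) using 1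
  rw [Finset.Nat.mem_antidiagonalTuple] at ht
  simp [wt, Prod.ext_iff, Prod.fst_sum, Prod.snd_sum, Finset.sum_add_distrib, ht,
    Fintype.card_subtype]

lemma genSeries_comp_perm (k : ℕ) (ty : Fin (k + 1) → Fin 3) (σ : Equiv.Perm (Fin (k + 1)))
    (N : ℕ) : genSeries k (ty ∘ σ) N = genSeries k ty N := by
  refine Finset.sum_equiv (Equiv.arrowCongr σ (Equiv.refl ℕ)) (fun t => ?_) (fun t _ => ?_)
  · simp [Finset.Nat.mem_antidiagonalTuple, Equiv.sum_comp σ.symm]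
  · rw [← Equiv.prod_comp σ (fun i => X (ty i, Equiv.arrowCongr σ (Equiv.refl ℕ) t i))]
    simp

/-- The polynomial `ẽ_n + h̃_n T + f̃_n T²`, that is `exp(T D) ẽ_n`. -/
noncomputable def expVar (n : ℕ) : Polynomial (MvPolynomial Vr ℂ) :=
  ∑ a : Fin 3, Polynomial.monomial (a : ℕ) (X (a, n))

lemma Dlow_coeff_mul {p q : Polynomial (MvPolynomial Vr ℂ)}
    (hp : ∀ j, Dlow (p.coeff j) = p.derivative.coeff j)
    (hq : ∀ j, Dlow (q.coeff j) = q.derivative.coeff j) (j : ℕ) :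
    Dlow ((p * q).coeff j) = (p * q).derivative.coeff j := by
  simp only [Polynomial.coeff_mul, map_sum, Derivation.leibniz, smul_eq_mul,
    Polynomial.derivative_mul, Polynomial.coeff_add, hp, hq, Finset.sum_add_distrib]
  rw [add_comm]
  simp only [mul_comm]

lemma Dlow_coeff_expVar (n j : ℕ) :
    Dlow ((expVar n).coeff j) = (expVar n).derivative.coeff j := by
  rw [Polynomial.coeff_derivative]
  rcases j with _ | _ | _ | j <;>
    simp [expVar, Fin.sum_univ_three, Polynomial.coeff_monomial, Dlow, mkDerivation_X,
      MvPolynomial.smul_eq_C_mul, mul_comm]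
  rw [mul_comm, show (C 2 : MvPolynomial Vr ℂ) = 2 from map_ofNat C 2, one_add_one_eq_two]

/-- The coefficient of `z^N` in `(exp(T D) ẽ(z))^{k+1}`. -/
noncomputable def expSeries (k N : ℕ) : Polynomial (MvPolynomial Vr ℂ) :=
  ∑ t ∈ Finset.Nat.antidiagonalTuple (k + 1) N, ∏ i, expVar (t i)

lemma Dlow_coeff_expSeries (k N j : ℕ) :
    Dlow ((expSeries k N).coeff j) = (expSeries k N).derivative.coeff j := by
  simp only [expSeries, Polynomial.finsetSum_coeff, map_sum]
  refine Finset.sum_congr rfl fun t _ => ?_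
  revert j
  refine Finset.prod_induction (fun i => expVar (t i))
    (fun p : Polynomial (MvPolynomial Vr ℂ) => ∀ j, Dlow (p.coeff j) = p.derivative.coeff j)
    (fun p q => Dlow_coeff_mul) (fun j => ?_) (fun i _ => Dlow_coeff_expVar _)
  rcases eq_or_ne j 0 with rfl | h <;> simp [Polynomial.coeff_one, *]

lemma coeff_expSeries (k N j : ℕ) :
    (expSeries k N).coeff j =
      ∑ ty : Fin (k + 1) → Fin 3 with ∑ i, (ty i : ℕ) = j, genSeries k ty N := by
  simp only [expSeries, expVar, Polynomial.finsetSum_coeff, genSeries, Finset.prod_univ_sum,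
    Fintype.piFinset_univ]
  rw [Finset.sum_comm, Finset.sum_filter]
  refine Finset.sum_congr rfl fun ty _ => ?_
  have h (t : Fin (k + 1) → ℕ) :
      ∏ i, Polynomial.monomial (ty i : ℕ) (X (ty i, t i) : MvPolynomial Vr ℂ) =
        Polynomial.monomial (∑ i, (ty i : ℕ)) (∏ i, X (ty i, t i)) := by
    simp only [← Polynomial.C_mul_X_pow_eq_monomial, Finset.prod_mul_distrib, map_prod,
      Finset.prod_pow_eq_pow_sum]
  simp only [h, Polynomial.coeff_monomial]
  split_ifs <;> simp

lemma Dlow_pow_genSeries (k N j : ℕ) :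
    (Dlow.toLinearMap ^ j) (genSeries k (fun _ => 0) N) =
      (j.factorial : ℂ) • (expSeries k N).coeff j := by
  induction j with
  | zero =>
    have : ({ty : Fin (k + 1) → Fin 3 | ∑ i, (ty i : ℕ) = 0} : Finset _) = {fun _ => 0} := by
      ext ty
      simp only [Finset.mem_filter, Finset.mem_univ, true_and, Finset.sum_eq_zero_iff,
        Finset.mem_singleton, funext_iff, Fin.ext_iff, forall_true_left]
      rfl
    rw [coeff_expSeries, this]
    simp
  | succ j ih =>
    rw [pow_succ', Module.End.mul_apply, ih, map_smul, Derivation.coeFn_coe,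
      Dlow_coeff_expSeries, Polynomial.coeff_derivative, Nat.factorial_succ]
    simp only [MvPolynomial.smul_eq_C_mul]
    push_cast
    simp
    ring

lemma coeff_expSeries_mem_idealA (k N j : ℕ) (hj : j ≤ 2 * k + 2) :
    (expSeries k N).coeff j ∈ idealA k := by
  have h : (j.factorial : ℂ) • (expSeries k N).coeff j ∈ idealA k :=
    Ideal.subset_span ⟨j, hj, N, (Dlow_pow_genSeries k N j).symm⟩
  have hj0 : (j.factorial : ℂ) ≠ 0 := by exact_mod_cast j.factorial_ne_zero
  simpa [smul_smul, inv_mul_cancel₀ hj0] using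
    (idealA k).smul_of_tower_mem ((j.factorial : ℂ)⁻¹) h

lemma card_fiber_add {n : ℕ} (ty : Fin n → Fin 3) :
    Fintype.card {i // ty i = 0} + Fintype.card {i // ty i = 1} +
      Fintype.card {i // ty i = 2} = n := by
  have := Finset.card_eq_sum_card_fiberwise (f := ty) (s := Finset.univ) (t := Finset.univ)
    (by simp)
  simp only [Fin.sum_univ_three, Finset.card_univ, Fintype.card_fin] at this
  simp only [Fintype.card_subtype]
  exact this.symm

lemma sum_val_eq_card_fiber {n : ℕ} (ty : Fin n → Fin 3) :
    ∑ i, (ty i : ℕ) = Fintype.card {i // ty i = 1} + 2 * Fintype.card {i // ty i = 2} := by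
  simp only [Fintype.card_subtype, Finset.card_filter, Finset.mul_sum, ← Finset.sum_add_distrib]
  refine Finset.sum_congr rfl fun i _ => ?_
  generalize ty i = a
  fin_cases a <;> simp

lemma sum_zdeg3_eq {n : ℕ} (ty : Fin n → Fin 3) :
    ∑ i, zdeg3 (ty i) = 2 * n - 2 * ((∑ i, (ty i : ℕ) : ℕ) : ℤ) := by
  have h (a : Fin 3) : zdeg3 a = 2 - 2 * ((a : ℕ) : ℤ) := by fin_cases a <;> simp [zdeg3]
  simp only [h, Finset.sum_sub_distrib, Finset.mul_sum, Nat.cast_sum]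
  simp [mul_comm]

/-- Modulo the ideal of `A_k`, the coefficients of `ẽ(z)^i h̃(z)^{k+1-i}` and of
`h̃(z)^i f̃(z)^{k+1-i}` are combinations of terms of lower degree in `h̃`. -/
lemma exists_sub_mem_lowerComp (k : ℕ) (ty₀ : Fin (k + 1) → Fin 3) (N : ℕ)
    (h₀ : (∀ i, ty₀ i ≠ 2) ∨ ∀ i, ty₀ i ≠ 0) :
    ∃ g ∈ idealA k, genSeries k ty₀ N - g ∈
      lowerComp (N + (k + 1), ∑ i, zdeg3 (ty₀ i), k + 1) (Fintype.card {i // ty₀ i = 1}) := by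
  classical
  set J := ∑ i, (ty₀ i : ℕ) with hJ
  have hcard₀ : Fintype.card {i // ty₀ i = 2} = 0 ∨ Fintype.card {i // ty₀ i = 0} = 0 := by
    simpa [Fintype.card_eq_zero_iff, isEmpty_subtype] using h₀
  have hJle : J ≤ 2 * k + 2 := by
    have := card_fiber_add ty₀
    have := sum_val_eq_card_fiber ty₀
    omega
  let S : Finset (Fin (k + 1) → Fin 3) := {ty | ∑ i, (ty i : ℕ) = J}
  let T : Finset (Fin (k + 1) → Fin 3) :=
    {ty ∈ S | Fintype.card {i // ty i = 1} = Fintype.card {i // ty₀ i = 1}}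
  let L : Finset (Fin (k + 1) → Fin 3) :=
    {ty ∈ S | ¬ Fintype.card {i // ty i = 1} = Fintype.card {i // ty₀ i = 1}}
  have hsplit : (expSeries k N).coeff J = ∑ ty ∈ T, genSeries k ty N +
      ∑ ty ∈ L, genSeries k ty N := by
    rw [coeff_expSeries, Finset.sum_filter_add_sum_filter_not]
  have hT : ∑ ty ∈ T, genSeries k ty N = (T.card : ℂ) • genSeries k ty₀ N := by
    rw [Nat.cast_smul_eq_nsmul]
    refine Finset.sum_eq_card_nsmul fun ty hty => ?_
    simp only [T, S, Finset.mem_filter, Finset.mem_univ, true_and] at hty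
    have hfib (a : Fin 3) : Nonempty ({i // ty i = a} ≃ {i // ty₀ i = a}) := by
      rw [← Fintype.card_eq]
      have h1 := card_fiber_add ty
      have h2 := card_fiber_add ty₀
      have h3 := sum_val_eq_card_fiber ty
      have h4 := sum_val_eq_card_fiber ty₀
      fin_cases a <;> simp only [Fin.zero_eta, Fin.mk_one, Fin.reduceFinMk] <;> omega
    let σ : Equiv.Perm (Fin (k + 1)) := Equiv.ofFiberEquiv fun a => (hfib a).some
    have hσ : ty = ty₀ ∘ σ := funext fun i => (Equiv.ofFiberEquiv_map _ i).symm
    rw [hσ, genSeries_comp_perm]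
  have hT0 : (T.card : ℂ) ≠ 0 := by
    have : ty₀ ∈ T := by simp [T, S, hJ]
    exact_mod_cast (Finset.card_pos.2 ⟨_, this⟩).ne'
  have hL : ∑ ty ∈ L, genSeries k ty N ∈
      lowerComp (N + (k + 1), ∑ i, zdeg3 (ty₀ i), k + 1) (Fintype.card {i // ty₀ i = 1}) := by
    refine Submodule.sum_mem _ fun ty hty => ?_
    simp only [L, S, Finset.mem_filter, Finset.mem_univ, true_and] at hty
    have hz : ∑ i, zdeg3 (ty₀ i) = ∑ i, zdeg3 (ty i) := by
      rw [sum_zdeg3_eq, sum_zdeg3_eq, hty.1]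
    rw [hz]
    refine mem_lowerComp_of_lt ?_ (genSeries_isWeightedHomogeneous k ty N)
    have h1 := card_fiber_add ty
    have h2 := card_fiber_add ty₀
    have h3 := sum_val_eq_card_fiber ty
    have h4 := sum_val_eq_card_fiber ty₀
    omega
  refine ⟨(T.card : ℂ)⁻¹ • (expSeries k N).coeff J,
    (idealA k).smul_of_tower_mem _ (coeff_expSeries_mem_idealA k N J hJle), ?_⟩
  rw [hsplit, hT, smul_add, smul_smul, inv_mul_cancel₀ hT0, one_smul, sub_add_cancel_left]
  exact Submodule.neg_mem _ (Submodule.smul_mem _ _ hL)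

lemma exists_eq_genSeries_of_mem_gens {k : ℕ} {p : MvPolynomial Vr ℂ}
    (hp : p ∈ { p | ∃ i, 1 ≤ i ∧ i ≤ k + 1 ∧
        ∃ N, p = genSeries k (fun j => if (j : ℕ) < i then (0 : Fin 3) else 1) N } ∪
     { p | ∃ i, i ≤ k + 1 ∧
        ∃ N, p = genSeries k (fun j => if (j : ℕ) < i then (1 : Fin 3) else 2) N }) :
    ∃ ty : Fin (k + 1) → Fin 3, ((∀ i, ty i ≠ 2) ∨ ∀ i, ty i ≠ 0) ∧
      ∃ N, p = genSeries k ty N := by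
  rcases hp with ⟨i, -, -, N, rfl⟩ | ⟨i, -, N, rfl⟩
  · exact ⟨_, Or.inl fun j => by split_ifs <;> decide, N, rfl⟩
  · exact ⟨_, Or.inr fun j => by split_ifs <;> decide, N, rfl⟩

/-- Multihomogeneous components of elements of the ideal of `B_k` are, modulo the ideal of `A_k`,
of lower degree in `h̃`. -/
lemma component_mem_of_mem_idealB (k : ℕ) (δ : ℕ × ℤ × ℕ) (m : ℕ) {p : MvPolynomial Vr ℂ}
    (hp : p ∈ idealB k) :
    weightedHomogeneousComponent wt (δ, m) p ∈
      (idealA k).restrictScalars ℂ ⊔ lowerComp δ m := by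
  suffices h : ∀ (q : MvPolynomial Vr ℂ) (ty : Fin (k + 1) → Fin 3) (N : ℕ),
      ((∀ i, ty i ≠ 2) ∨ ∀ i, ty i ≠ 0) →
      weightedHomogeneousComponent wt (δ, m) (q * genSeries k ty N) ∈
        (idealA k).restrictScalars ℂ ⊔ lowerComp δ m by
    rw [idealB] at hp
    induction hp using Submodule.closure_induction with
    | zero => simp
    | add x y _ _ hx hy => rw [map_add]; exact add_mem hx hy
    | smul_mem q x hx =>
      obtain ⟨ty, hty, N, rfl⟩ := exists_eq_genSeries_of_mem_gens hx
      exact h q ty N hty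
  intro q ty N hty
  induction q using MvPolynomial.induction_on' with
  | add q r hq hr => rw [add_mul, map_add]; exact add_mem hq hr
  | monomial u a =>
    have hhom := (isWeightedHomogeneous_monomial wt u a rfl).mul
      (genSeries_isWeightedHomogeneous k ty N)
    by_cases hdeg : (δ, m) = Finsupp.weight wt u +
        ((N + (k + 1), ∑ i, zdeg3 (ty i), k + 1), Fintype.card {i // ty i = 1})
    · rw [hdeg, hhom.weightedHomogeneousComponent_same]
      obtain ⟨g, hg, hlow⟩ := exists_sub_mem_lowerComp k ty N hty
      obtain ⟨rfl, rfl⟩ := Prod.ext_iff.1 hdeg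
      have := monomial_mul_mem_lowerComp hlow u a
      rw [← add_sub_cancel (monomial u a * g) (monomial u a * genSeries k ty N), ← mul_sub]
      exact Submodule.add_mem_sup ((idealA k).mul_mem_left _ hg) this
    · rw [hhom.weightedHomogeneousComponent_ne _ hdeg]
      exact zero_mem _

lemma finite_setOf_qdegMon_eq (d : ℕ) : {u : Vr →₀ ℕ | qdegMon u = d}.Finite := by
  refine (Set.finite_Iic (Finsupp.indicator (Finset.univ ×ˢ Finset.range d)
    fun _ _ => d : Vr →₀ ℕ)).subset fun u hu v => ?_
  by_cases hv : u v = 0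
  · simp [hv]
  · have hle : u v * (v.2 + 1) ≤ d := by
      rw [← show qdegMon u = d from hu]
      exact Finset.single_le_sum (f := fun v => u v * (v.2 + 1)) (fun _ _ => Nat.zero_le _)
        (Finsupp.mem_support_iff.2 hv)
    have hpos : 0 < u v := Nat.pos_of_ne_zero hv
    have hlt : v.2 < d := by nlinarith
    rw [Finsupp.indicator_apply, dif_pos (by simp [hlt])]
    nlinarith

/-- Monomials spanning a homogeneous component modulo the ideal of `B_k` span it modulo the
ideal of `A_k`. -/
lemma weightedHomogeneousSubmodule_le_of_spans (k : ℕ) (δ : ℕ × ℤ × ℕ) (b : Set (Vr →₀ ℕ))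
    (hb : ∀ u : Vr →₀ ℕ, (Finsupp.weight wt u).1 = δ →
      ∃ x ∈ Submodule.span ℂ ((fun u => monomial u (1 : ℂ)) '' b), monomial u 1 - x ∈ idealB k)
    (m : ℕ) :
    weightedHomogeneousSubmodule ℂ wt (δ, m) ≤
      (idealA k).restrictScalars ℂ ⊔ Submodule.span ℂ ((fun u => monomial u (1 : ℂ)) '' b) := by
  induction m using Nat.strong_induction_on with
  | _ m ih =>
    intro p hp
    rw [p.as_sum]
    refine Submodule.sum_mem _ fun u hu => ?_
    have hwt : Finsupp.weight wt u = (δ, m) := hp (mem_support_iff.1 hu)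
    rw [← mul_one (coeff u p), ← smul_eq_mul, ← smul_monomial]
    refine Submodule.smul_mem _ _ ?_
    obtain ⟨x, hx, hux⟩ := hb u (by rw [hwt])
    have hcomp := component_mem_of_mem_idealB k δ m hux
    rw [map_sub, (isWeightedHomogeneous_monomial wt u (1 : ℂ)
      hwt).weightedHomogeneousComponent_same] at hcomp
    have hxm : weightedHomogeneousComponent wt (δ, m) x ∈
        Submodule.span ℂ ((fun u => monomial u (1 : ℂ)) '' b) := by
      suffices Submodule.span ℂ ((fun u => monomial u (1 : ℂ)) '' b) ≤
          (Submodule.span ℂ ((fun u => monomial u (1 : ℂ)) '' b)).comap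
            (weightedHomogeneousComponent wt (δ, m)) from this hx
      rw [Submodule.span_le]
      rintro _ ⟨v, hv, rfl⟩
      classical
      rw [SetLike.mem_coe, Submodule.mem_comap, weightedHomogeneousComponent_of_mem
        (isWeightedHomogeneous_monomial wt v (1 : ℂ) rfl)]
      split_ifs
      · exact Submodule.subset_span ⟨v, hv, rfl⟩
      · exact zero_mem _
    rw [← sub_add_cancel (monomial u 1) (weightedHomogeneousComponent wt (δ, m) x)]
    exact add_mem (sup_le le_sup_left (iSup₂_le ih) hcomp) (Submodule.mem_sup_right hxm)

/-- For `k ≥ 1` and all `d, s ≥ 0`, `w ∈ ℤ`, the dimension of the homogeneous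
component of `A_k` of q-degree `d`, z-degree `2w` and u-degree `s` is at most the dimension of the
corresponding homogeneous component of `B_k`. -/
theorem stmt3 (k : ℕ) (hk : 1 ≤ k) (d s : ℕ) (w : ℤ) :
    Module.finrank ℂ
        ↥((comp3 d (2 * w) s).map (Ideal.Quotient.mkₐ ℂ (idealA k)).toLinearMap) ≤
      Module.finrank ℂ
        ↥((comp3 d (2 * w) s).map (Ideal.Quotient.mkₐ ℂ (idealB k)).toLinearMap) := by
  have hmkB (x : MvPolynomial Vr ℂ) :
      (Ideal.Quotient.mkₐ ℂ (idealB k)).toLinearMap x = 0 ↔ x ∈ idealB k :=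
    Ideal.Quotient.eq_zero_iff_mem
  have hmkA (x : MvPolynomial Vr ℂ) :
      (Ideal.Quotient.mkₐ ℂ (idealA k)).toLinearMap x = 0 ↔ x ∈ idealA k :=
    Ideal.Quotient.eq_zero_iff_mem
  set πA := (Ideal.Quotient.mkₐ ℂ (idealA k)).toLinearMap
  set πB := (Ideal.Quotient.mkₐ ℂ (idealB k)).toLinearMap
  let mon : (Vr →₀ ℕ) → MvPolynomial Vr ℂ := fun u => monomial u 1
  let T : Set (Vr →₀ ℕ) := {u | (qdegMon u, zdegMon u, udegMon u) = (d, 2 * w, s)}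
  have hcomp : comp3 d (2 * w) s = Submodule.span ℂ (mon '' T) := by
    unfold comp3
    congr 1
    ext p
    simp [mon, T, and_assoc, eq_comm]
  obtain ⟨b, hbT, -, hspan, hli⟩ := exists_linearIndepOn_extension
    (linearIndepOn_empty ℂ (πB ∘ mon)) (Set.empty_subset T)
  have hbfin : b.Finite := (finite_setOf_qdegMon_eq d).subset fun u hu =>
    (Prod.ext_iff.1 (hbT hu)).1
  have := hbfin.fintype
  have hB : Fintype.card b ≤ Module.finrank ℂ ((comp3 d (2 * w) s).map πB) := by
    have hmap : (comp3 d (2 * w) s).map πB =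
        Submodule.span ℂ (Set.range fun u : b => (πB ∘ mon) u) := by
      rw [hcomp, Submodule.map_span, ← Set.image_comp, ← Set.image_eq_range]
      exact le_antisymm (Submodule.span_le.2 hspan) (Submodule.span_mono (Set.image_mono hbT))
    rw [hmap, finrank_span_eq_card hli]
  have hA : (comp3 d (2 * w) s).map πA ≤
      Submodule.span ℂ (Set.range fun u : b => πA (mon u)) := by
    rw [Submodule.map_le_iff_le_comap, hcomp, Submodule.span_le]
    rintro _ ⟨u, hu, rfl⟩
    have hle := weightedHomogeneousSubmodule_le_of_spans k (d, 2 * w, s) b (fun v hv => by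
      rw [weight_wt_fst] at hv
      have hv' := hspan ⟨v, hv, rfl⟩
      rw [Set.image_comp, SetLike.mem_coe, ← Submodule.map_span] at hv'
      obtain ⟨x, hx, hxv⟩ := hv'
      refine ⟨x, hx, (hmkB _).1 ?_⟩
      rw [map_sub, hxv]
      exact sub_self _) (Finsupp.weight wt u).2
    have hu' : mon u ∈ weightedHomogeneousSubmodule ℂ wt
        ((d, 2 * w, s), (Finsupp.weight wt u).2) :=
      isWeightedHomogeneous_monomial wt u 1 (Prod.ext ((weight_wt_fst u).trans hu) rfl)
    obtain ⟨y, hy, x, hx, hyx⟩ := Submodule.mem_sup.1 (hle hu')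
    rw [SetLike.mem_coe, Submodule.mem_comap, ← hyx, map_add, (hmkA y).2 hy, zero_add]
    have := Submodule.mem_map_of_mem (f := πA) hx
    rwa [Submodule.map_span, ← Set.image_comp, Set.image_eq_range] at this
  have hfin : Module.Finite ℂ (Submodule.span ℂ (Set.range fun u : b => πA (mon u))) :=
    Module.Finite.span_of_finite ℂ (Set.finite_range _)
  exact ((Submodule.finrank_mono hA).trans (finrank_range_le_card _)).trans hB
end

section
/- For all integers d ≥ 0, s ≥ 0 and w ∈ ℤ, the dimension over ℂ of the homogeneous component of B_1 of q-degree d, z-degree 2w and u-degree s is at most the number of ehf-triples (a_i, b_i, c_i)_{i≥1} with ∑_i i(a_i+b_i+c_i) = d, ∑_i (a_i+b_i+c_i) = s and ∑_i (c_i − a_i) = w. -/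
open MvPolynomial

/-- An ehf-triple: a finitely supported sequence `(a_i, b_i, c_i)_{i ≥ 1}` (the argument `i : ℕ`
stands for the index `i+1`) with `a_i + a_{i+1} + b_{i+1} ≤ 1`, `a_i + b_{i+1} + c_{i+1} ≤ 1`,
`a_i + b_i + c_{i+1} ≤ 1` and `b_i + c_i + c_{i+1} ≤ 1` for all `i ≥ 1`. -/
def IsEhf (a b c : ℕ →₀ ℕ) : Prop :=
  ∀ i : ℕ, a i + a (i + 1) + b (i + 1) ≤ 1 ∧ a i + b (i + 1) + c (i + 1) ≤ 1 ∧
    a i + b i + c (i + 1) ≤ 1 ∧ b i + c i + c (i + 1) ≤ 1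

/-- Comparison of a function `G` satisfying the sub-recurrences of the algebra dimensions with
functions `S`, `S'` satisfying the super-recurrences of the counts of ehf-triples. -/
theorem le_of_recurrences (G : ℕ → ℕ → ℕ → ℤ → ℤ → ℤ → ℕ) (S S' : ℕ → ℤ → ℤ → ℤ → ℕ)
    (hGa : ∀ (p q r : ℕ) (d s w : ℤ), G p q r d s w ≤
      G (p + 1) q r d s w + G (p + 2) (q + 1) r (d - (p + 1)) (s - 1) (w + 1))
    (hGb : ∀ (p q r : ℕ) (d s w : ℤ), G p q r d s w ≤
      G p (q + 1) r d s w + G (p + 1) (q + 2) (r + 1) (d - (q + 1)) (s - 1) w)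
    (hGc : ∀ (p q r : ℕ) (d s w : ℤ), G p q r d s w ≤
      G p q (r + 1) d s w + G p (q + 1) (r + 2) (d - (r + 1)) (s - 1) (w - 1))
    (hG : ∀ (p q r : ℕ) (d s w : ℤ), d ≤ p → d ≤ q → d ≤ r →
      G p q r d s w ≤ if d = 0 ∧ s = 0 ∧ w = 0 then 1 else 0)
    (hS : ∀ (i : ℕ) (d s w : ℤ), S' i d s w + S' (i + 1) (d - (i + 1)) (s - 1) (w - 1) +
      S (i + 2) (d - (i + 1) - (i + 1)) (s - 1 - 1) (w - 1 + 1) ≤ S i d s w)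
    (hS' : ∀ (i : ℕ) (d s w : ℤ), S (i + 1) d s w + S (i + 2) (d - (i + 1)) (s - 1) (w + 1) +
      S' (i + 1) (d - (i + 1)) (s - 1) w ≤ S' i d s w)
    (hS0 : ∀ i, 1 ≤ S i 0 0 0) (hS0' : ∀ i, 1 ≤ S' i 0 0 0)
    (i : ℕ) (d s w : ℤ) : G i i i d s w ≤ S i d s w := by
  suffices H : ∀ (k i : ℕ) (d : ℤ), d ≤ i + k → ∀ s w : ℤ,
      G i i i d s w ≤ S i d s w ∧ G i i (i + 1) d s w ≤ S' i d s w ∧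
      G (i + 1) (i + 1) i d s (w + 1) + G i (i + 1) (i + 1) d s w ≤
        S (i + 1) d s (w + 1) + S' i d s w from
    (H (d - i).toNat i d (by omega) s w).1
  have base : ∀ (p q r i : ℕ) (d s w : ℤ), d ≤ p → d ≤ q → d ≤ r → G p q r d s w ≤ S i d s w := by
    intro p q r i d s w h1 h2 h3
    refine (hG p q r d s w h1 h2 h3).trans ?_
    split_ifs with h
    · obtain ⟨rfl, rfl, rfl⟩ := h
      exact hS0 i
    · exact Nat.zero_le _
  have base' : ∀ (p q r i : ℕ) (d s w : ℤ), d ≤ p → d ≤ q → d ≤ r →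
      G p q r d s w ≤ S' i d s w := by
    intro p q r i d s w h1 h2 h3
    refine (hG p q r d s w h1 h2 h3).trans ?_
    split_ifs with h
    · obtain ⟨rfl, rfl, rfl⟩ := h
      exact hS0' i
    · exact Nat.zero_le _
  intro k
  induction k with
  | zero =>
    intro i d hd s w
    exact ⟨base _ _ _ _ _ _ _ (by omega) (by omega) (by omega),
      base' _ _ _ _ _ _ _ (by omega) (by omega) (by omega),
      add_le_add (base _ _ _ _ _ _ _ (by omega) (by omega) (by omega))
        (base' _ _ _ _ _ _ _ (by omega) (by omega) (by omega))⟩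
  | succ k ih =>
    intro i d hd s w
    have hc : G i i (i + 1) d s w ≤ S' i d s w := by
      have h1 := hGa i i (i + 1) d s w
      have h2 := hGb (i + 1) i (i + 1) d s w
      have h3 := hGb (i + 2) (i + 1) (i + 1) (d - (i + 1)) (s - 1) (w + 1)
      have h4 := hGc (i + 2) (i + 2) (i + 1) (d - (i + 1)) (s - 1) (w + 1)
      have k1 := (ih (i + 1) d (by push_cast; omega) s w).1
      have k2 := (ih (i + 2) (d - (i + 1)) (by push_cast; omega) (s - 1) (w + 1)).1
      have k3 := (ih (i + 2) (d - (i + 1)) (by push_cast; omega) (s - 1) w).1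
      have k4 := (ih (i + 2) (d - (i + 1) - (i + 1 + 1)) (by push_cast; omega)
        (s - 1 - 1) w).2.2
      have l1 := hS' i d s w
      have l2 := hS' (i + 1) (d - (i + 1)) (s - 1) w
      push_cast at *
      simp only [add_assoc, add_sub_cancel_right, Nat.reduceAdd] at *
      omega
    refine ⟨?_, hc, ?_⟩
    · have h1 := hGc i i i d s w
      have h2 := hGa i (i + 1) (i + 2) (d - (i + 1)) (s - 1) (w - 1)
      have k1 := (ih (i + 1) (d - (i + 1)) (by push_cast; omega) (s - 1) (w - 1)).2.1
      have k2 := (ih (i + 2) (d - (i + 1) - (i + 1)) (by push_cast; omega)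
        (s - 1 - 1) (w - 1 + 1)).1
      have l1 := hS i d s w
      simp only [add_assoc, Nat.reduceAdd] at *
      omega
    · have h1 := hGc (i + 1) (i + 1) i d s (w + 1)
      have h2 := hGa i (i + 1) (i + 1) d s w
      have k1 := (ih (i + 1) d (by push_cast; omega) s (w + 1)).1
      have k2 := (ih (i + 1) d (by push_cast; omega) s w).1
      have k3 := (ih (i + 1) (d - (i + 1)) (by push_cast; omega) (s - 1) w).2.2
      have l1 := hS' i d s w
      simp only [add_assoc, add_sub_cancel_right, Nat.reduceAdd] at *
      omega

/-- Over an index type with finitely many indices of each weight, only finitely many multisets have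
a given bounded total weight. -/
theorem finite_setOf_sum_le {σ : Type*} (f : σ → ℕ) (hf : ∀ v, 0 < f v)
    (hfin : ∀ d, {v | f v ≤ d}.Finite) (d : ℕ) :
    {u : σ →₀ ℕ | (u.sum fun v m => m * f v) ≤ d}.Finite := by
  classical
  refine (Set.finite_Iic (∑ v ∈ (hfin d).toFinset, Finsupp.single v d)).subset ?_
  intro u hu
  rw [Set.mem_Iic, Finsupp.le_def]
  intro v
  by_cases hv : u v = 0
  · simp [hv]
  have h1 : u v * f v ≤ d :=
    (Finset.single_le_sum (f := fun v => u v * f v) (fun _ _ => Nat.zero_le _)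
      (Finsupp.mem_support_iff.2 hv)).trans hu
  have h2 : u v ≤ d := (Nat.le_mul_of_pos_right _ (hf v)).trans h1
  have h3 : f v ≤ d := (Nat.le_mul_of_pos_left _ (Nat.pos_of_ne_zero hv)).trans h1
  rw [Finsupp.finsetSum_apply]
  refine h2.trans ?_
  simpa using Finset.single_le_sum (f := fun x => Finsupp.single x d v)
    (fun _ _ => Nat.zero_le _) ((hfin d).mem_toFinset.2 h3)

/-- The weight `∑ (i + 1) a_i` of a finitely supported sequence. -/
def seqWeight (a : ℕ →₀ ℕ) : ℕ := a.sum fun i m => (i + 1) * m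

/-- The total `∑ a_i` of a finitely supported sequence. -/
def seqTotal (a : ℕ →₀ ℕ) : ℕ := a.sum fun _ m => m

theorem seqWeight_add_single (a : ℕ →₀ ℕ) (i : ℕ) :
    seqWeight (a + Finsupp.single i 1) = seqWeight a + (i + 1) := by
  rw [seqWeight, Finsupp.sum_add_index' (by simp) (by intros; ring)]
  simp [seqWeight]

theorem seqTotal_add_single (a : ℕ →₀ ℕ) (i : ℕ) :
    seqTotal (a + Finsupp.single i 1) = seqTotal a + 1 := by
  rw [seqTotal, Finsupp.sum_add_index' (by simp) (by intros; ring)]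
  simp [seqTotal]

/-- The ehf-triples vanishing below index `i`, with prescribed degrees. -/
def ehfFrom (i : ℕ) (d s w : ℤ) : Set ((ℕ →₀ ℕ) × (ℕ →₀ ℕ) × (ℕ →₀ ℕ)) :=
  { t | IsEhf t.1 t.2.1 t.2.2 ∧ (∀ j < i, t.1 j = 0 ∧ t.2.1 j = 0 ∧ t.2.2 j = 0) ∧
    (seqWeight t.1 : ℤ) + seqWeight t.2.1 + seqWeight t.2.2 = d ∧
    (seqTotal t.1 : ℤ) + seqTotal t.2.1 + seqTotal t.2.2 = s ∧
    (seqTotal t.2.2 : ℤ) - seqTotal t.1 = w }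

/-- The triples of `ehfFrom i d s w` with `c_i = 0`. -/
def ehfFrom' (i : ℕ) (d s w : ℤ) : Set ((ℕ →₀ ℕ) × (ℕ →₀ ℕ) × (ℕ →₀ ℕ)) :=
  { t ∈ ehfFrom i d s w | t.2.2 i = 0 }

theorem finite_seqWeight_le (d : ℕ) : {a : ℕ →₀ ℕ | seqWeight a ≤ d}.Finite := by
  have := finite_setOf_sum_le (fun i : ℕ => i + 1) (fun _ => Nat.succ_pos _)
    (fun d => (Set.finite_Iic d).subset fun i (hi : i + 1 ≤ d) => by
      rw [Set.mem_Iic]; omega) d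
  simpa only [seqWeight, mul_comm] using this

theorem finite_ehfFrom (i : ℕ) (d s w : ℤ) : (ehfFrom i d s w).Finite := by
  have h := finite_seqWeight_le d.toNat
  refine (h.prod (h.prod h)).subset ?_
  rintro ⟨a, b, c⟩ ⟨-, -, h, -, -⟩
  refine ⟨?_, ?_, ?_⟩ <;> simp only [Set.mem_ofPred_eq] at h ⊢ <;> omega

theorem finite_ehfFrom' (i : ℕ) (d s w : ℤ) : (ehfFrom' i d s w).Finite :=
  (finite_ehfFrom i d s w).subset fun _ h => h.1

/-- Three finite sets embedded injectively, with disjoint images, in a finite set. -/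
theorem ncard_add_le {α : Type*} {A B C T : Set α} (hT : T.Finite) (g h : α → α)
    (hg : Set.InjOn g B) (hh : Set.InjOn h C)
    (hA : A ⊆ T) (hB : ∀ x ∈ B, g x ∈ T) (hC : ∀ x ∈ C, h x ∈ T)
    (hAB : ∀ x ∈ B, g x ∉ A) (hAC : ∀ x ∈ C, h x ∉ A) (hBC : ∀ x ∈ B, ∀ y ∈ C, g x ≠ h y) :
    A.ncard + B.ncard + C.ncard ≤ T.ncard := by
  have hB' : g '' B ⊆ T := Set.image_subset_iff.2 hB
  have hC' : h '' C ⊆ T := Set.image_subset_iff.2 hC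
  rw [← hg.ncard_image, ← hh.ncard_image,
    ← Set.ncard_union_eq _ (hT.subset hA) (hT.subset hB'),
    ← Set.ncard_union_eq _ (hT.subset (Set.union_subset hA hB')) (hT.subset hC')]
  · exact Set.ncard_le_ncard (Set.union_subset (Set.union_subset hA hB') hC') hT
  · rw [Set.disjoint_left]
    rintro _ hx ⟨y, hy, rfl⟩
    rcases hx with hx | ⟨x, hx, hxy⟩
    · exact hAC y hy hx
    · exact hBC x hx y hy hxy
  · rw [Set.disjoint_left]
    rintro _ hx ⟨y, hy, rfl⟩
    exact hAB y hy hx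

theorem zero_mem_ehfFrom (i : ℕ) : (0 : (ℕ →₀ ℕ) × (ℕ →₀ ℕ) × (ℕ →₀ ℕ)) ∈ ehfFrom i 0 0 0 := by
  refine ⟨fun j => by simp, fun j _ => by simp, ?_, ?_, ?_⟩ <;> simp [seqWeight, seqTotal]

theorem one_le_ncard_ehfFrom (i : ℕ) : 1 ≤ (ehfFrom i 0 0 0).ncard :=
  (Set.ncard_pos (finite_ehfFrom i 0 0 0)).2 ⟨0, zero_mem_ehfFrom i⟩

theorem one_le_ncard_ehfFrom' (i : ℕ) : 1 ≤ (ehfFrom' i 0 0 0).ncard :=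
  (Set.ncard_pos (finite_ehfFrom' i 0 0 0)).2 ⟨0, zero_mem_ehfFrom i, rfl⟩

theorem ncard_ehfFrom_ge (i : ℕ) (d s w : ℤ) :
    (ehfFrom' i d s w).ncard + (ehfFrom' (i + 1) (d - (i + 1)) (s - 1) (w - 1)).ncard +
      (ehfFrom (i + 2) (d - (i + 1) - (i + 1)) (s - 1 - 1) (w - 1 + 1)).ncard ≤
    (ehfFrom i d s w).ncard := by
  refine ncard_add_le (finite_ehfFrom i d s w)
    (fun t => (t.1, t.2.1, t.2.2 + Finsupp.single i 1))
    (fun t => (t.1 + Finsupp.single i 1, t.2.1, t.2.2 + Finsupp.single i 1))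
    ?_ ?_ (fun _ h => h.1) ?_ ?_ ?_ ?_ ?_
  · rintro ⟨a, b, c⟩ - ⟨a', b', c'⟩ - h
    simpa using h
  · rintro ⟨a, b, c⟩ - ⟨a', b', c'⟩ - h
    simpa using h
  · rintro ⟨a, b, c⟩ ⟨⟨h1, h2, h3, h4, h5⟩, h6⟩
    refine ⟨fun j => ?_, fun j hj => ?_, ?_, ?_, ?_⟩
    · have k := h1 j
      have k0 := h2 j
      have k1 := h2 (j + 1)
      simp only [Finsupp.add_apply, Finsupp.single_apply] at *
      split_ifs <;> first | omega | (subst_vars; omega)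
    · have k0 := h2 j
      simp only [Finsupp.add_apply, Finsupp.single_apply] at *
      split_ifs <;> omega
    all_goals
      simp only [seqWeight_add_single, seqTotal_add_single] at *
      push_cast
      omega
  · rintro ⟨a, b, c⟩ ⟨h1, h2, h3, h4, h5⟩
    refine ⟨fun j => ?_, fun j hj => ?_, ?_, ?_, ?_⟩
    · have k := h1 j
      have k0 := h2 j
      have k1 := h2 (j + 1)
      simp only [Finsupp.add_apply, Finsupp.single_apply] at *
      split_ifs <;> omega
    · have k0 := h2 j
      simp only [Finsupp.add_apply, Finsupp.single_apply] at *
      split_ifs <;> omega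
    all_goals
      simp only [seqWeight_add_single, seqTotal_add_single] at *
      push_cast
      omega
  · rintro ⟨a, b, c⟩ - ⟨-, h⟩
    simp at h
  · rintro ⟨a, b, c⟩ - ⟨-, h⟩
    simp at h
  · rintro ⟨a, b, c⟩ ⟨⟨-, h, -⟩, -⟩ ⟨a', b', c'⟩ - h'
    have := (h i (Nat.lt_succ_self i)).1
    simp only [Prod.mk.injEq] at h' this
    rw [h'.1] at this
    simp at this

theorem ncard_ehfFrom'_ge (i : ℕ) (d s w : ℤ) :
    (ehfFrom (i + 1) d s w).ncard + (ehfFrom (i + 2) (d - (i + 1)) (s - 1) (w + 1)).ncard +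
      (ehfFrom' (i + 1) (d - (i + 1)) (s - 1) w).ncard ≤ (ehfFrom' i d s w).ncard := by
  refine ncard_add_le (finite_ehfFrom' i d s w)
    (fun t => (t.1 + Finsupp.single i 1, t.2.1, t.2.2))
    (fun t => (t.1, t.2.1 + Finsupp.single i 1, t.2.2)) ?_ ?_ ?_ ?_ ?_ ?_ ?_ ?_
  · rintro ⟨a, b, c⟩ - ⟨a', b', c'⟩ - h
    simpa using h
  · rintro ⟨a, b, c⟩ - ⟨a', b', c'⟩ - h
    simpa using h
  · rintro ⟨a, b, c⟩ ⟨h1, h2, h3⟩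
    exact ⟨⟨h1, fun j hj => h2 j (by omega), h3⟩, (h2 i (by omega)).2.2⟩
  · rintro ⟨a, b, c⟩ ⟨h1, h2, h3, h4, h5⟩
    refine ⟨⟨fun j => ?_, fun j hj => ?_, ?_, ?_, ?_⟩, (h2 i (by omega)).2.2⟩
    · have k := h1 j
      have k0 := h2 j
      have k1 := h2 (j + 1)
      simp only [Finsupp.add_apply, Finsupp.single_apply] at *
      split_ifs <;> omega
    · have k0 := h2 j
      simp only [Finsupp.add_apply, Finsupp.single_apply] at *
      split_ifs <;> omega
    all_goals
      simp only [seqWeight_add_single, seqTotal_add_single] at *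
      push_cast
      omega
  · rintro ⟨a, b, c⟩ ⟨⟨h1, h2, h3, h4, h5⟩, h6⟩
    refine ⟨⟨fun j => ?_, fun j hj => ?_, ?_, ?_, ?_⟩, (h2 i (by omega)).2.2⟩
    · have k := h1 j
      have k0 := h2 j
      have k1 := h2 (j + 1)
      simp only [Finsupp.add_apply, Finsupp.single_apply] at *
      split_ifs <;> first | omega | (subst_vars; omega)
    · have k0 := h2 j
      simp only [Finsupp.add_apply, Finsupp.single_apply] at *
      split_ifs <;> omega
    all_goals
      simp only [seqWeight_add_single, seqTotal_add_single] at *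
      push_cast
      omega
  · rintro ⟨a, b, c⟩ - ⟨-, h, -⟩
    simpa using (h i (Nat.lt_succ_self i)).1
  · rintro ⟨a, b, c⟩ - ⟨-, h, -⟩
    simpa using (h i (Nat.lt_succ_self i)).2.1
  · rintro ⟨a, b, c⟩ - ⟨a', b', c'⟩ ⟨⟨-, h, -⟩, -⟩ h'
    have := (h i (Nat.lt_succ_self i)).1
    simp only [Prod.mk.injEq] at h' this
    rw [← h'.1] at this
    simp at this

/-- The (q, u, z)-degree of a monomial. -/
noncomputable def tridegree (u : Vr →₀ ℕ) : ℤ × ℤ × ℤ := (qdegMon u, udegMon u, zdegMon u)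

theorem tridegree_zero : tridegree 0 = 0 := by
  simp [tridegree, qdegMon, udegMon, zdegMon]

theorem tridegree_add (u v : Vr →₀ ℕ) : tridegree (u + v) = tridegree u + tridegree v := by
  unfold tridegree qdegMon udegMon zdegMon
  rw [Finsupp.sum_add_index' (by simp) (by intros; ring),
    Finsupp.sum_add_index' (by simp) (by intros; ring),
    Finsupp.sum_add_index' (by simp) (by intros; push_cast; ring)]
  simp

theorem tridegree_single (v : Vr) :
    tridegree (Finsupp.single v 1) = ((v.2 : ℤ) + 1, 1, zdeg3 v.1) := by
  simp [tridegree, qdegMon, udegMon, zdegMon]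

/-- The order of vanishing imposed between two families of variables; it is positive exactly when
the product of the two series vanishes in `B_1`. -/
def pairing : Fin 3 → Fin 3 → ℕ := ![![2, 1, 0], ![1, 2, 1], ![0, 1, 2]]

/-- The `N`-th coefficient of `x̃(z) ỹ(z)`. -/
noncomputable def quadRel (x y : Fin 3) (N : ℕ) : MvPolynomial Vr ℂ :=
  ∑ t ∈ Finset.HasAntidiagonal.antidiagonal N, X (x, t.1) * X (y, t.2)

theorem genSeries_one (ty : Fin 2 → Fin 3) (N : ℕ) :
    genSeries 1 ty N = quadRel (ty 0) (ty 1) N := by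
  simp [genSeries, quadRel, Finset.Nat.antidiagonalTuple_two]

theorem quadRel_comm (x y : Fin 3) (N : ℕ) : quadRel x y N = quadRel y x N := by
  unfold quadRel
  conv_lhs => rw [← Finset.HasAntidiagonal.map_swap_antidiagonal, Finset.sum_map]
  exact Finset.sum_congr rfl fun t _ => mul_comm _ _

theorem quadRel_mem_idealB {x y : Fin 3} (h : pairing x y ≠ 0) (N : ℕ) :
    quadRel x y N ∈ idealB 1 := by
  have h1 : ∀ i, 1 ≤ i → i ≤ 2 →
      quadRel (if 0 < i then 0 else 1) (if 1 < i then 0 else 1) N ∈ idealB 1 := fun i hi hi' =>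
    Ideal.subset_span (Or.inl ⟨i, hi, hi', N, by simp [genSeries_one]⟩)
  have h2 : ∀ i ≤ 2, quadRel (if 0 < i then 1 else 2) (if 1 < i then 1 else 2) N ∈ idealB 1 :=
    fun i hi => Ideal.subset_span (Or.inr ⟨i, hi, N, by simp [genSeries_one]⟩)
  have e1 := h1 1 le_rfl (by norm_num)
  have e2 := h1 2 (by norm_num) le_rfl
  have f0 := h2 0 (by norm_num)
  have f1 := h2 1 (by norm_num)
  have f2 := h2 2 le_rfl
  have e1' := quadRel_comm 0 1 N ▸ e1
  have f1' := quadRel_comm 1 2 N ▸ f1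
  fin_cases x <;> fin_cases y <;> first | assumption | exact absurd rfl h

/-- The homogeneous component of the polynomial ring of degree `δ`. -/
noncomputable def homComp (δ : ℤ × ℤ × ℤ) : Submodule ℂ (MvPolynomial Vr ℂ) :=
  Submodule.span ℂ {p | ∃ u, tridegree u = δ ∧ p = monomial u 1}

/-- The degree `δ` part of the ideal generated by the quadratic relations of `B_1` and by the
variables `(x, i)` with `i < α x`. -/
noncomputable def relComp (α : Fin 3 → ℕ) (δ : ℤ × ℤ × ℤ) : Submodule ℂ (MvPolynomial Vr ℂ) :=
  Submodule.span ℂ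
    ({p | ∃ u v, v.2 < α v.1 ∧ tridegree (u + Finsupp.single v 1) = δ ∧
        p = monomial (u + Finsupp.single v 1) 1} ∪
     {p | ∃ u x y j k, pairing x y ≠ 0 ∧
        tridegree (u + Finsupp.single (x, j) 1 + Finsupp.single (y, k) 1) = δ ∧
        p = monomial u 1 * quadRel x y (j + k)})

theorem relComp_zero_le (δ : ℤ × ℤ × ℤ) :
    relComp 0 δ ≤ (idealB 1).restrictScalars ℂ := by
  refine Submodule.span_le.2 ?_
  rintro _ (⟨u, v, hv, -⟩ | ⟨u, x, y, j, k, h, -, rfl⟩)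
  · exact absurd hv (Nat.not_lt_zero _)
  · exact Ideal.mul_mem_left _ _ (quadRel_mem_idealB h _)

theorem X_mul_monomial (v : Vr) (u : Vr →₀ ℕ) :
    (X v * monomial u 1 : MvPolynomial Vr ℂ) = monomial (u + Finsupp.single v 1) 1 := by
  rw [X, monomial_mul, one_mul, add_comm]

theorem monomial_mem_homComp (u : Vr →₀ ℕ) : monomial u 1 ∈ homComp (tridegree u) :=
  Submodule.subset_span ⟨u, rfl, rfl⟩

theorem monomial_mem_relComp {α : Fin 3 → ℕ} {u : Vr →₀ ℕ} {v : Vr} (hv : v.2 < α v.1)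
    (h : u v ≠ 0) : monomial u 1 ∈ relComp α (tridegree u) := by
  have hu : u - Finsupp.single v 1 + Finsupp.single v 1 = u :=
    tsub_add_cancel_of_le (Finsupp.single_le_iff.2 (Nat.one_le_iff_ne_zero.2 h))
  exact Submodule.subset_span (Or.inl ⟨u - Finsupp.single v 1, v, hv, by rw [hu], by rw [hu]⟩)

/-- If a sum lies in a subspace and all its terms are either in the subspace or equal to `m`, and
some term is `m`, then `m` lies in the subspace. -/
theorem mem_of_sum_mem {ι M : Type*} [AddCommGroup M] [Module ℂ M] (W : Submodule ℂ M)
    (S : Finset ι) (f : ι → M) (m : M) (hsum : ∑ t ∈ S, f t ∈ W)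
    (h : ∀ t ∈ S, f t ∈ W ∨ f t = m) (hm : ∃ t ∈ S, f t = m) : m ∈ W := by
  classical
  by_contra hmW
  rw [← Finset.sum_filter_add_sum_filter_not S (fun t => f t ∈ W),
    W.add_mem_iff_right (W.sum_mem fun t ht => (Finset.mem_filter.1 ht).2),
    Finset.sum_congr rfl (g := fun _ => m) fun t ht =>
      (h t (Finset.mem_filter.1 ht).1).resolve_left (Finset.mem_filter.1 ht).2,
    Finset.sum_const, ← Nat.cast_smul_eq_nsmul ℂ] at hsum
  obtain ⟨t, ht, rfl⟩ := hm
  have hcard : ((S.filter fun t' => f t' ∉ W).card : ℂ) ≠ 0 :=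
    Nat.cast_ne_zero.2 (Finset.card_ne_zero_of_mem (Finset.mem_filter.2 ⟨ht, hmW⟩))
  exact hmW ((W.smul_mem_iff hcard).1 hsum)

theorem monomial_pair_mem_relComp (α : Fin 3 → ℕ) (x y : Fin 3) (i : ℕ)
    (hi : i < α y + pairing x y) (u : Vr →₀ ℕ) :
    monomial (u + Finsupp.single (x, α x) 1 + Finsupp.single (y, i) 1) 1 ∈
      relComp α (tridegree (u + Finsupp.single (x, α x) 1 + Finsupp.single (y, i) 1)) := by
  rcases lt_or_ge i (α y) with hlt | hge
  · exact monomial_mem_relComp (v := (y, i)) hlt (by simp)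
  have hp : pairing x y ≠ 0 := by omega
  have hdeg : ∀ j k, j + k = α x + i →
      tridegree (u + Finsupp.single (x, j) 1 + Finsupp.single (y, k) 1) =
      tridegree (u + Finsupp.single (x, α x) 1 + Finsupp.single (y, i) 1) := by
    intro j k hjk
    simp only [tridegree_add, tridegree_single, add_assoc, Prod.mk_add_mk]
    have : (j : ℤ) + k = α x + i := by exact_mod_cast hjk
    congr 2
    linarith
  refine mem_of_sum_mem _ (Finset.HasAntidiagonal.antidiagonal (α x + i))
    (fun t => monomial (u + Finsupp.single (x, t.1) 1 + Finsupp.single (y, t.2) 1) 1) _ ?_ ?_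
    ⟨(α x, i), by simp, rfl⟩
  · have : monomial u 1 * quadRel x y (α x + i) ∈
        relComp α (tridegree (u + Finsupp.single (x, α x) 1 + Finsupp.single (y, i) 1)) :=
      Submodule.subset_span (Or.inr ⟨u, x, y, α x, i, hp, rfl, rfl⟩)
    convert this using 1
    rw [quadRel, Finset.mul_sum]
    refine Finset.sum_congr rfl fun t _ => ?_
    rw [← X_mul_monomial, ← X_mul_monomial]
    ring
  · rintro ⟨j, k⟩ ht
    have hjk : j + k = α x + i := Finset.HasAntidiagonal.mem_antidiagonal.1 ht
    simp only
    rcases lt_trichotomy j (α x) with hj | hj | hj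
    · left
      rw [← hdeg j k hjk]
      exact monomial_mem_relComp (v := (x, j)) hj (by simp)
    · right
      rw [hj, show k = i by omega]
    · rcases lt_or_ge k (α y) with hk | hk
      · left
        rw [← hdeg j k hjk]
        exact monomial_mem_relComp (v := (y, k)) hk (by simp)
      · right
        have hxy : x = y := by
          by_contra hxy
          have : pairing x y ≤ 1 := by
            revert hxy; clear * -; revert x y; decide
          omega
        subst hxy
        have : pairing x x = 2 := by clear * -; revert x; decide
        rw [show j = i by omega, show k = α x by omega, add_right_comm]

/-- The first surviving variable of family `x` annihilates the next `pairing x y` surviving variables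
of each family `y`, modulo the relations. -/
theorem map_mulLeft_relComp_le (α : Fin 3 → ℕ) (x : Fin 3) (δ : ℤ × ℤ × ℤ) :
    (relComp (α + pairing x) (δ - tridegree (Finsupp.single (x, α x) 1))).map
      (LinearMap.mulLeft ℂ (X (x, α x))) ≤ relComp α δ := by
  rw [relComp, Submodule.map_span_le]
  rintro _ (⟨u, ⟨y, i⟩, hv, hdeg, rfl⟩ | ⟨u, y, y', j, k, h, hdeg, rfl⟩)
  · rw [LinearMap.mulLeft_apply, X_mul_monomial, add_right_comm]
    rw [eq_sub_iff_add_eq, ← tridegree_add, add_right_comm] at hdeg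
    rw [← hdeg]
    exact monomial_pair_mem_relComp α x y i hv u
  · rw [LinearMap.mulLeft_apply, ← mul_assoc, X_mul_monomial]
    rw [eq_sub_iff_add_eq, ← tridegree_add] at hdeg
    refine Submodule.subset_span (Or.inr ⟨_, y, y', j, k, h, ?_, rfl⟩)
    rw [← hdeg]
    congr 1
    abel

theorem relComp_add_single_le (α : Fin 3 → ℕ) (x : Fin 3) (δ : ℤ × ℤ × ℤ) :
    relComp (α + Pi.single x 1) δ ≤ relComp α δ ⊔
      (homComp (δ - tridegree (Finsupp.single (x, α x) 1))).map
        (LinearMap.mulLeft ℂ (X (x, α x))) := by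
  refine Submodule.span_le.2 ?_
  rintro _ (⟨u, ⟨y, i⟩, hv, hdeg, rfl⟩ | h)
  · rcases lt_or_ge i (α y) with hi | hi
    · exact Submodule.mem_sup_left (Submodule.subset_span (Or.inl ⟨u, (y, i), hi, hdeg, rfl⟩))
    · obtain rfl : y = x := by
        by_contra hyx
        simp [hyx] at hv
        omega
      obtain rfl : i = α y := by
        simp at hv
        omega
      refine Submodule.mem_sup_right ⟨monomial u 1, ?_, X_mul_monomial _ _⟩
      rw [← hdeg, tridegree_add, add_sub_cancel_right]
      exact monomial_mem_homComp u
  · exact Submodule.mem_sup_left (Submodule.subset_span (Or.inr h))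

/-- The least number of elements spanning `homComp δ` modulo `relComp α δ`. -/
noncomputable def spanNum (α : Fin 3 → ℕ) (δ : ℤ × ℤ × ℤ) : ℕ :=
  sInf {k | ∃ T : Finset (MvPolynomial Vr ℂ), T.card ≤ k ∧
    homComp δ ≤ Submodule.span ℂ T ⊔ relComp α δ}

theorem finite_tridegree_eq (δ : ℤ × ℤ × ℤ) : {u | tridegree u = δ}.Finite := by
  refine (finite_setOf_sum_le (fun v : Vr => v.2 + 1) (fun _ => Nat.succ_pos _) (fun d => ?_)
    δ.1.toNat).subset ?_
  · refine ((Set.finite_univ (α := Fin 3)).prod (Set.finite_Iic d)).subset fun v hv => ?_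
    exact ⟨Set.mem_univ _, Set.mem_Iic.2 (Nat.le_of_succ_le hv)⟩
  · rintro u rfl
    exact (Int.toNat_natCast (qdegMon u)).ge

theorem exists_card_le_spanNum (α : Fin 3 → ℕ) (δ : ℤ × ℤ × ℤ) :
    ∃ T : Finset (MvPolynomial Vr ℂ), T.card ≤ spanNum α δ ∧
      homComp δ ≤ Submodule.span ℂ T ⊔ relComp α δ := by
  classical
  refine Nat.sInf_mem (s := {k | ∃ T : Finset (MvPolynomial Vr ℂ), T.card ≤ k ∧
    homComp δ ≤ Submodule.span ℂ T ⊔ relComp α δ}) ⟨_, (finite_tridegree_eq δ).toFinset.image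
      (fun u => monomial u 1), le_rfl, le_sup_of_le_left (Submodule.span_mono ?_)⟩
  rintro _ ⟨u, hu, rfl⟩
  exact Finset.mem_coe.2 (Finset.mem_image_of_mem _ ((finite_tridegree_eq δ).mem_toFinset.2 hu))

theorem spanNum_le (α : Fin 3 → ℕ) (δ : ℤ × ℤ × ℤ) (T : Finset (MvPolynomial Vr ℂ))
    (h : homComp δ ≤ Submodule.span ℂ T ⊔ relComp α δ) : spanNum α δ ≤ T.card :=
  Nat.sInf_le ⟨T, le_rfl, h⟩

theorem spanNum_le_add (α : Fin 3 → ℕ) (x : Fin 3) (δ : ℤ × ℤ × ℤ) :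
    spanNum α δ ≤ spanNum (α + Pi.single x 1) δ +
      spanNum (α + pairing x) (δ - ((α x : ℤ) + 1, 1, zdeg3 x)) := by
  classical
  obtain ⟨T₁, hc₁, hT₁⟩ := exists_card_le_spanNum (α + Pi.single x 1) δ
  obtain ⟨T₂, hc₂, hT₂⟩ := exists_card_le_spanNum (α + pairing x)
    (δ - tridegree (Finsupp.single (x, α x) 1))
  rw [← tridegree_single (x, α x)]
  refine (spanNum_le α δ (T₁ ∪ T₂.image (LinearMap.mulLeft ℂ (X (x, α x)))) ?_).trans
    ((Finset.card_union_le _ _).trans (add_le_add hc₁ (Finset.card_image_le.trans hc₂)))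
  rw [Finset.coe_union, Finset.coe_image, Submodule.span_union, Submodule.span_image]
  have h := Submodule.map_mono (f := LinearMap.mulLeft ℂ (X (x, α x))) hT₂
  rw [Submodule.map_sup] at h
  refine hT₁.trans (sup_le (le_sup_of_le_left le_sup_left) ?_)
  refine (relComp_add_single_le α x δ).trans (sup_le le_sup_right (h.trans ?_))
  exact sup_le (le_sup_of_le_left le_sup_right) (le_sup_of_le_right (map_mulLeft_relComp_le α x δ))

theorem spanNum_le_ite (α : Fin 3 → ℕ) (δ : ℤ × ℤ × ℤ) (h : ∀ y, δ.1 ≤ α y) :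
    spanNum α δ ≤ if δ = 0 then 1 else 0 := by
  classical
  refine (spanNum_le α δ (if δ = 0 then {1} else ∅) (Submodule.span_le.2 ?_)).trans
    (by split_ifs <;> simp)
  rintro _ ⟨u, rfl, rfl⟩
  by_cases hu : u = 0
  · subst hu
    refine Submodule.mem_sup_left (Submodule.subset_span ?_)
    simp [tridegree_zero]
  · obtain ⟨v, hv⟩ := Finsupp.ne_iff.1 hu
    refine Submodule.mem_sup_right (monomial_mem_relComp (v := v) ?_ hv)
    have h1 : u v * (v.2 + 1) ≤ qdegMon u :=
      Finset.single_le_sum (f := fun v : Vr => u v * (v.2 + 1)) (fun _ _ => Nat.zero_le _)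
        (Finsupp.mem_support_iff.2 hv)
    have h2 := Nat.le_mul_of_pos_left (v.2 + 1) (Nat.pos_of_ne_zero hv)
    have h3 : (qdegMon u : ℤ) ≤ α v.1 := h v.1
    omega

theorem finrank_comp3_le (d s : ℕ) (z : ℤ) :
    Module.finrank ℂ ↥((comp3 d z s).map (Ideal.Quotient.mkₐ ℂ (idealB 1)).toLinearMap) ≤
      spanNum 0 (d, s, z) := by
  classical
  obtain ⟨T, hc, hT⟩ := exists_card_le_spanNum 0 (d, s, z)
  have hcomp : comp3 d z s ≤ homComp (d, s, z) := by
    refine Submodule.span_mono ?_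
    rintro _ ⟨u, rfl, rfl, rfl, rfl⟩
    exact ⟨u, rfl, rfl⟩
  have hle : (comp3 d z s).map (Ideal.Quotient.mkₐ ℂ (idealB 1)).toLinearMap ≤
      Submodule.span ℂ (T.image (Ideal.Quotient.mkₐ ℂ (idealB 1)).toLinearMap :
        Finset (MvPolynomial Vr ℂ ⧸ idealB 1)) := by
    refine (Submodule.map_mono (hcomp.trans hT)).trans ?_
    rw [Submodule.map_sup, Finset.coe_image, Submodule.span_image]
    refine sup_le le_rfl ?_
    rw [Submodule.map_le_iff_le_comap]
    intro p hp
    have hp0 : (Ideal.Quotient.mkₐ ℂ (idealB 1)).toLinearMap p = 0 :=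
      Ideal.Quotient.eq_zero_iff_mem.2 (relComp_zero_le _ hp)
    rw [Submodule.mem_comap, hp0]
    exact zero_mem _
  exact (Submodule.finrank_mono hle).trans
    ((finrank_span_finset_le_card _).trans (Finset.card_image_le.trans hc))

/-- For all `d, s ≥ 0` and `w ∈ ℤ`, the dimension of the homogeneous component
of `B_1` of q-degree `d`, z-degree `2w` and u-degree `s` is at most the number of ehf-triples
with `∑_i i(a_i+b_i+c_i) = d`, `∑_i (a_i+b_i+c_i) = s` and `∑_i (c_i - a_i) = w`. -/
theorem stmt8 (d s : ℕ) (w : ℤ) :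
    Module.finrank ℂ
        ↥((comp3 d (2 * w) s).map (Ideal.Quotient.mkₐ ℂ (idealB 1)).toLinearMap) ≤
      { t : (ℕ →₀ ℕ) × (ℕ →₀ ℕ) × (ℕ →₀ ℕ) |
          IsEhf t.1 t.2.1 t.2.2 ∧
          t.1.sum (fun i m => (i + 1) * m) + t.2.1.sum (fun i m => (i + 1) * m) +
            t.2.2.sum (fun i m => (i + 1) * m) = d ∧
          t.1.sum (fun _ m => m) + t.2.1.sum (fun _ m => m) + t.2.2.sum (fun _ m => m) = s ∧
          (t.2.2.sum (fun _ m => m) : ℤ) - t.1.sum (fun _ m => m) = w }.ncard := by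
  refine (finrank_comp3_le d s (2 * w)).trans ?_
  have key := le_of_recurrences
    (fun p q r d s w => spanNum ![r, q, p] (d, s, 2 * w))
    (fun i d s w => (ehfFrom i d s w).ncard) (fun i d s w => (ehfFrom' i d s w).ncard)
    ?_ ?_ ?_ ?_ ncard_ehfFrom_ge ncard_ehfFrom'_ge one_le_ncard_ehfFrom one_le_ncard_ehfFrom'
    0 d s w
  · have h0 : (![0, 0, 0] : Fin 3 → ℕ) = 0 := by simp
    rw [h0] at key
    refine key.trans_eq (congrArg Set.ncard (Set.ext fun t => ?_))
    simp only [ehfFrom, seqWeight, seqTotal, Set.mem_ofPred_eq, Nat.not_lt_zero,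
      IsEmpty.forall_iff, implies_true, true_and, ← Nat.cast_inj (R := ℤ),
      Nat.cast_add, Nat.cast_finsupp_sum]
  · intro p q r d s w
    convert spanNum_le_add ![r, q, p] 2 (d, s, 2 * w) using 3
    · ext x
      fin_cases x <;> rfl
    · ext x
      fin_cases x <;> rfl
    · simp [zdeg3]
      ring
  · intro p q r d s w
    convert spanNum_le_add ![r, q, p] 1 (d, s, 2 * w) using 3
    · ext x
      fin_cases x <;> rfl
    · ext x
      fin_cases x <;> rfl
    · simp [zdeg3]
  · intro p q r d s w
    convert spanNum_le_add ![r, q, p] 0 (d, s, 2 * w) using 3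
    · ext x
      fin_cases x <;> rfl
    · ext x
      fin_cases x <;> rfl
    · simp [zdeg3]
      ring
  · intro p q r d s w hp hq hr
    refine (spanNum_le_ite ![r, q, p] (d, s, 2 * w) ?_).trans (le_of_eq ?_)
    · intro y
      fin_cases y <;> assumption
    · simp [Prod.ext_iff]
end
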